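/- arXiv:2602.10374 — 2 statements merged into one kernel-verified Lean document; each statement's English description precedes it below -/
import Mathlib

section
/- Suppose Ŷ is poised for quadratic interpolation of f̂, with unique interpolant coefficients (ĝ, Ĥ), and let (α, H) be the unique minimizer of the full-space MN problem. Then for every x̂ ∈ ℝᵈ and every v ∈ col(Q)⊥, f(x⁰) + αᵀ(Q x̂ + v) + ½ (Q x̂ + v)ᵀ H (Q x̂ + v) = f̂(0) + ĝᵀ x̂ + ½ x̂ᵀ Ĥ x̂. -/
open Matrix

/-- Squared Frobenius norm of a real matrix. -/
noncomputable def frobSq {a b : ℕ} (A : Matrix (Fin a) (Fin b) ℝ) : ℝ :=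
  ∑ i, ∑ j, (A i j) ^ 2

/-- Squared Euclidean norm of a real vector. -/
noncomputable def vecNormSq {a : ℕ} (v : Fin a → ℝ) : ℝ :=
  ∑ i, (v i) ^ 2

/-- `v` lies in the orthogonal complement of the column space of `Q`. -/
def inColPerp {n d : ℕ} (Q : Matrix (Fin n) (Fin d) ℝ) (v : Fin n → ℝ) : Prop :=
  ∀ u : Fin d → ℝ, Q.mulVec u ⬝ᵥ v = 0

/-- Feasibility for the quadratic interpolation constraints: `p = (α, H)` with `H`
symmetric and `(dᵢ)ᵀ α + ½ (dᵢ)ᵀ H dᵢ = rhs i` for all `i`. -/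
def QFeas {k m : ℕ} (dd : Fin m → Fin k → ℝ) (rhs : Fin m → ℝ)
    (p : (Fin k → ℝ) × Matrix (Fin k) (Fin k) ℝ) : Prop :=
  p.2.IsSymm ∧ ∀ i, dd i ⬝ᵥ p.1 + (1 / 2) * (dd i ⬝ᵥ p.2.mulVec (dd i)) = rhs i

/-- Objective of the minimum norm (MN) problem. -/
noncomputable def MNObj {k : ℕ} (p : (Fin k → ℝ) × Matrix (Fin k) (Fin k) ℝ) : ℝ :=
  (1 / 2) * vecNormSq p.1 + (1 / 2) * frobSq p.2

/-- `p` is a minimizer of the MN problem. -/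
def MNMin {k m : ℕ} (dd : Fin m → Fin k → ℝ) (rhs : Fin m → ℝ)
    (p : (Fin k → ℝ) × Matrix (Fin k) (Fin k) ℝ) : Prop :=
  QFeas dd rhs p ∧ ∀ q, QFeas dd rhs q → MNObj p ≤ MNObj q

/-- Objective of the minimum Frobenius norm (MFN) problem. -/
noncomputable def MFNObj {k : ℕ} (p : (Fin k → ℝ) × Matrix (Fin k) (Fin k) ℝ) : ℝ :=
  (1 / 2) * frobSq p.2

/-- `p` is a minimizer of the MFN problem. -/
def MFNMin {k m : ℕ} (dd : Fin m → Fin k → ℝ) (rhs : Fin m → ℝ)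
    (p : (Fin k → ℝ) × Matrix (Fin k) (Fin k) ℝ) : Prop :=
  QFeas dd rhs p ∧ ∀ q, QFeas dd rhs q → MFNObj p ≤ MFNObj q

/-- Objective of the least Frobenius norm updating (LFU) problem. -/
noncomputable def LFUObj {k : ℕ} (Hbar : Matrix (Fin k) (Fin k) ℝ)
    (p : (Fin k → ℝ) × Matrix (Fin k) (Fin k) ℝ) : ℝ :=
  (1 / 2) * frobSq (p.2 - Hbar)

/-- `p` is a minimizer of the LFU problem with reference matrix `Hbar`. -/
def LFUMin {k m : ℕ} (dd : Fin m → Fin k → ℝ) (rhs : Fin m → ℝ)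
    (Hbar : Matrix (Fin k) (Fin k) ℝ)
    (p : (Fin k → ℝ) × Matrix (Fin k) (Fin k) ℝ) : Prop :=
  QFeas dd rhs p ∧ ∀ q, QFeas dd rhs q → LFUObj Hbar p ≤ LFUObj Hbar q

/-- `X` is a Moore–Penrose pseudoinverse of `A`. -/
def IsMPInv {a b : ℕ} (A : Matrix (Fin a) (Fin b) ℝ) (X : Matrix (Fin b) (Fin a) ℝ) : Prop :=
  A * X * A = A ∧ X * A * X = X ∧ (A * X)ᵀ = A * X ∧ (X * A)ᵀ = X * A

/-- The vector `δ_g(y⁰; W)` with `i`-th entry `g(y⁰ + wⁱ) − g(y⁰)`,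
where `wⁱ` is the `i`-th column of `W`. -/
noncomputable def deltaVec {k p : ℕ} (g : (Fin k → ℝ) → ℝ) (y0 : Fin k → ℝ)
    (W : Matrix (Fin k) (Fin p) ℝ) : Fin p → ℝ :=
  fun i => g (y0 + fun j => W j i) - g y0

section ProjectionLemmas

variable {n d p : ℕ}

theorem vecNormSq_eq_dotProduct (v : Fin n → ℝ) : vecNormSq v = v ⬝ᵥ v := by
  simp [vecNormSq, dotProduct, sq]

theorem frobSq_transpose (A : Matrix (Fin n) (Fin p) ℝ) : frobSq Aᵀ = frobSq A :=
  Finset.sum_comm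

theorem frobSq_eq_sum_col (A : Matrix (Fin n) (Fin p) ℝ) :
    frobSq A = ∑ j, vecNormSq (A.col j) :=
  Finset.sum_comm

theorem mulVec_dotProduct_eq_transpose (Q : Matrix (Fin n) (Fin d) ℝ) (a : Fin d → ℝ)
    (w : Fin n → ℝ) : Q *ᵥ a ⬝ᵥ w = a ⬝ᵥ Qᵀ *ᵥ w := by
  rw [dotProduct_mulVec, vecMul_transpose]

theorem dotProduct_conj_mulVec (Q : Matrix (Fin n) (Fin d) ℝ) (G : Matrix (Fin d) (Fin d) ℝ)
    (w : Fin n → ℝ) :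
    w ⬝ᵥ (Q * G * Qᵀ) *ᵥ w = Qᵀ *ᵥ w ⬝ᵥ G *ᵥ (Qᵀ *ᵥ w) := by
  rw [mulVec_dotProduct_eq_transpose, transpose_transpose, mulVec_mulVec, mulVec_mulVec,
    Matrix.mul_assoc]

theorem transpose_mulVec_mulVec {Q : Matrix (Fin n) (Fin d) ℝ} (hQ : Qᵀ * Q = 1)
    (x : Fin d → ℝ) : Qᵀ *ᵥ (Q *ᵥ x) = x := by
  rw [mulVec_mulVec, hQ, one_mulVec]

theorem transpose_mulVec_eq_zero_of_inColPerp {Q : Matrix (Fin n) (Fin d) ℝ} {v : Fin n → ℝ}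
    (hv : inColPerp Q v) : Qᵀ *ᵥ v = 0 := by
  refine dotProduct_eq_zero _ fun u => ?_
  rw [dotProduct_comm, ← mulVec_dotProduct_eq_transpose]
  exact hv u

/-- Orthogonal projection does not increase the Euclidean norm. -/
theorem vecNormSq_proj_le {Q : Matrix (Fin n) (Fin d) ℝ} (hQ : Qᵀ * Q = 1) (v : Fin n → ℝ) :
    vecNormSq (Q *ᵥ (Qᵀ *ᵥ v)) ≤ vecNormSq v := by
  have h₁ : Q *ᵥ (Qᵀ *ᵥ v) ⬝ᵥ Q *ᵥ (Qᵀ *ᵥ v) = Q *ᵥ (Qᵀ *ᵥ v) ⬝ᵥ v := by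
    rw [mulVec_dotProduct_eq_transpose, transpose_mulVec_mulVec hQ,
      mulVec_dotProduct_eq_transpose Q (Qᵀ *ᵥ v) v]
  have h₂ : 0 ≤ vecNormSq (v - Q *ᵥ (Qᵀ *ᵥ v)) := Finset.sum_nonneg fun _ _ => sq_nonneg _
  rw [vecNormSq_eq_dotProduct] at h₂ ⊢
  rw [vecNormSq_eq_dotProduct]
  rw [sub_dotProduct, dotProduct_sub, dotProduct_sub, h₁,
    dotProduct_comm v (Q *ᵥ (Qᵀ *ᵥ v))] at h₂
  linarith

theorem frobSq_proj_mul_le {Q : Matrix (Fin n) (Fin d) ℝ} (hQ : Qᵀ * Q = 1)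
    (A : Matrix (Fin n) (Fin p) ℝ) : frobSq (Q * (Qᵀ * A)) ≤ frobSq A := by
  rw [frobSq_eq_sum_col, frobSq_eq_sum_col]
  exact Finset.sum_le_sum fun j _ => vecNormSq_proj_le hQ (A.col j)

theorem frobSq_conj_proj_le {Q : Matrix (Fin n) (Fin d) ℝ} (hQ : Qᵀ * Q = 1)
    (H : Matrix (Fin n) (Fin n) ℝ) : frobSq (Q * (Qᵀ * H * Q) * Qᵀ) ≤ frobSq H := by
  calc frobSq (Q * (Qᵀ * H * Q) * Qᵀ)
      = frobSq (Q * (Qᵀ * (H * (Q * Qᵀ)))) := by simp only [Matrix.mul_assoc]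
    _ ≤ frobSq (H * (Q * Qᵀ)) := frobSq_proj_mul_le hQ _
    _ = frobSq (Q * (Qᵀ * Hᵀ)) := by
      rw [← frobSq_transpose]
      simp only [transpose_mul, transpose_transpose, Matrix.mul_assoc]
    _ ≤ frobSq Hᵀ := frobSq_proj_mul_le hQ _
    _ = frobSq H := frobSq_transpose H

end ProjectionLemmas

/-- If `Ŷ` is poised for quadratic interpolation of `f̂` with unique
interpolant coefficients `(ĝ, Ĥ)` and `(α, H)` is the unique minimizer of the
full-space MN problem, then for every `x̂ ∈ ℝᵈ` and `v ∈ col(Q)⊥`,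
`f(x⁰) + αᵀ(Q x̂ + v) + ½ (Q x̂ + v)ᵀ H (Q x̂ + v) = f̂(0) + ĝᵀ x̂ + ½ x̂ᵀ Ĥ x̂`. -/
theorem stmt_3 {n d m : ℕ} (hn : 0 < n) (hd : 0 < d) (hm : 0 < m) (hdn : d < n)
    (Q : Matrix (Fin n) (Fin d) ℝ) (hQ : Qᵀ * Q = 1)
    (f : (Fin n → ℝ) → ℝ) (x0 : Fin n → ℝ) (dh : Fin m → Fin d → ℝ)
    (fh : (Fin d → ℝ) → ℝ) (hfh : ∀ xh, fh xh = f (x0 + Q.mulVec xh))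
    (gh : Fin d → ℝ) (Hh : Matrix (Fin d) (Fin d) ℝ) (hHhsymm : Hh.IsSymm)
    (hInterp : ∀ i, fh 0 + gh ⬝ᵥ dh i + (1 / 2) * (dh i ⬝ᵥ Hh.mulVec (dh i)) = fh (dh i))
    (hPoised : ∀ (g' : Fin d → ℝ) (H' : Matrix (Fin d) (Fin d) ℝ), H'.IsSymm →
      (∀ i, fh 0 + g' ⬝ᵥ dh i + (1 / 2) * (dh i ⬝ᵥ H'.mulVec (dh i)) = fh (dh i)) →
      g' = gh ∧ H' = Hh)
    (α : Fin n → ℝ) (H : Matrix (Fin n) (Fin n) ℝ)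
    (hmin : MNMin (fun i => Q.mulVec (dh i))
      (fun i => f (x0 + Q.mulVec (dh i)) - f x0) (α, H))
    (huniq : ∀ p, MNMin (fun i => Q.mulVec (dh i))
      (fun i => f (x0 + Q.mulVec (dh i)) - f x0) p → p = (α, H)) :
    ∀ (xh : Fin d → ℝ) (v : Fin n → ℝ), inColPerp Q v →
      f x0 + α ⬝ᵥ (Q.mulVec xh + v)
        + (1 / 2) * ((Q.mulVec xh + v) ⬝ᵥ H.mulVec (Q.mulVec xh + v))
      = fh 0 + gh ⬝ᵥ xh + (1 / 2) * (xh ⬝ᵥ Hh.mulVec xh) := by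
  have hsymm : (Qᵀ * H * Q).IsSymm := by
    have hH : Hᵀ = H := hmin.1.1
    simp only [Matrix.IsSymm, transpose_mul, transpose_transpose, hH, Matrix.mul_assoc]
  have hquad (y : Fin d → ℝ) :
      Q *ᵥ y ⬝ᵥ H *ᵥ (Q *ᵥ y) = y ⬝ᵥ (Qᵀ * H * Q) *ᵥ y := by
    rw [mulVec_dotProduct_eq_transpose, mulVec_mulVec, mulVec_mulVec, Matrix.mul_assoc]
  have hfeas : QFeas (fun i => Q *ᵥ dh i) (fun i => f (x0 + Q *ᵥ dh i) - f x0)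
      (Q *ᵥ (Qᵀ *ᵥ α), Q * (Qᵀ * H * Q) * Qᵀ) := by
    refine ⟨?_, fun i => ?_⟩
    · change (Q * (Qᵀ * H * Q) * Qᵀ)ᵀ = _
      rw [transpose_mul, transpose_mul, hsymm.eq, transpose_transpose, ← Matrix.mul_assoc]
    · have h := hmin.1.2 i
      simp only [hquad] at h
      simp only [dotProduct_conj_mulVec, mulVec_dotProduct_eq_transpose,
        transpose_mulVec_mulVec hQ] at h ⊢
      exact h
  have hobj : MNObj (Q *ᵥ (Qᵀ *ᵥ α), Q * (Qᵀ * H * Q) * Qᵀ) ≤ MNObj (α, H) := by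
    have h₁ := vecNormSq_proj_le hQ α
    have h₂ := frobSq_conj_proj_le hQ H
    simp only [MNObj]
    linarith
  obtain ⟨hα, hH⟩ := Prod.mk.inj
    (huniq _ ⟨hfeas, fun q hq => hobj.trans (hmin.2 q hq)⟩)
  have hf0 : fh 0 = f x0 := by rw [hfh, mulVec_zero, add_zero]
  obtain ⟨hg, hG⟩ := hPoised (Qᵀ *ᵥ α) (Qᵀ * H * Q) hsymm fun i => by
    have h := hmin.1.2 i
    simp only [hquad] at h
    rw [mulVec_dotProduct_eq_transpose, dotProduct_comm] at h
    rw [hf0, hfh]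
    linarith
  rw [hg] at hα
  rw [hG] at hH
  intro xh v hv
  have hw : Qᵀ *ᵥ (Q *ᵥ xh + v) = xh := by
    rw [mulVec_add, transpose_mulVec_mulVec hQ, transpose_mulVec_eq_zero_of_inColPerp hv,
      add_zero]
  rw [← hα, ← hH, mulVec_dotProduct_eq_transpose, dotProduct_conj_mulVec, hw, hf0]
end

section
/- Suppose the full-space MFN problem is feasible. Let (α, H) be a minimizer of the full-space MFN problem and (α̂, Ĥ) a minimizer of the subspace MFN problem such that α = Q α̂. Then for every x̂ ∈ ℝᵈ and every v ∈ col(Q)⊥, the associated models satisfy m(x⁰ + Q x̂ + v) = m̂(x̂). -/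
open Matrix

theorem frobSq_nonneg {a b : ℕ} (A : Matrix (Fin a) (Fin b) ℝ) : 0 ≤ frobSq A :=
  Finset.sum_nonneg fun _ _ => Finset.sum_nonneg fun _ _ => sq_nonneg _

theorem eq_zero_of_frobSq_nonpos {a b : ℕ} {A : Matrix (Fin a) (Fin b) ℝ}
    (h : frobSq A ≤ 0) : A = 0 := by
  have h0 : frobSq A = 0 := le_antisymm h (frobSq_nonneg A)
  ext i j
  have hi := (Finset.sum_eq_zero_iff_of_nonneg fun _ _ =>
    Finset.sum_nonneg fun _ _ => sq_nonneg _).mp h0 i (Finset.mem_univ i)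
  have hij := (Finset.sum_eq_zero_iff_of_nonneg fun _ _ => sq_nonneg _).mp hi j
    (Finset.mem_univ j)
  exact (pow_eq_zero_iff two_ne_zero).mp hij

theorem frobSq_eq_trace {a b : ℕ} (A : Matrix (Fin a) (Fin b) ℝ) :
    frobSq A = (A * Aᵀ).trace := by
  simp [frobSq, Matrix.trace, Matrix.mul_apply, sq]

/-- Parallelogram identity for the Frobenius norm. -/
theorem frobSq_midpoint {a b : ℕ} (A B : Matrix (Fin a) (Fin b) ℝ) :
    4 * frobSq ((1 / 2 : ℝ) • (A + B)) + frobSq (A - B) = 2 * frobSq A + 2 * frobSq B := by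
  simp only [frobSq, Finset.mul_sum, ← Finset.sum_add_distrib]
  refine Finset.sum_congr rfl fun i _ => Finset.sum_congr rfl fun j _ => ?_
  simp only [Matrix.smul_apply, Matrix.add_apply, Matrix.sub_apply, smul_eq_mul]
  ring

/-- Embedding a matrix along orthonormal columns preserves the Frobenius norm. -/
theorem frobSq_conj {n d : ℕ} {Q : Matrix (Fin n) (Fin d) ℝ} (hQ : Qᵀ * Q = 1)
    (A : Matrix (Fin d) (Fin d) ℝ) : frobSq (Q * A * Qᵀ) = frobSq A := by
  have h : Q * A * Qᵀ * (Q * A * Qᵀ)ᵀ = Q * (A * Aᵀ * Qᵀ) := by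
    simp only [Matrix.transpose_mul, Matrix.transpose_transpose, Matrix.mul_assoc]
    rw [← Matrix.mul_assoc Qᵀ Q, hQ, Matrix.one_mul]
  rw [frobSq_eq_trace, frobSq_eq_trace, h, Matrix.trace_mul_comm, Matrix.mul_assoc, hQ,
    Matrix.mul_one]

/-- Compressing a matrix to orthonormal columns does not increase the Frobenius norm. -/
theorem frobSq_compress_le {n d : ℕ} {Q : Matrix (Fin n) (Fin d) ℝ} (hQ : Qᵀ * Q = 1)
    (A : Matrix (Fin n) (Fin n) ℝ) : frobSq (Qᵀ * A * Q) ≤ frobSq A := by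
  set B := Qᵀ * A * Q with hB
  have hcross : (A * (Q * B * Qᵀ)ᵀ).trace = frobSq B := by
    have h : A * (Q * B * Qᵀ)ᵀ = (A * Q * Bᵀ) * Qᵀ := by
      simp only [Matrix.transpose_mul, Matrix.transpose_transpose, Matrix.mul_assoc]
    rw [h, Matrix.trace_mul_comm, frobSq_eq_trace, ← Matrix.mul_assoc, ← Matrix.mul_assoc, ← hB]
  have hcross' : ((Q * B * Qᵀ) * Aᵀ).trace = frobSq B := by
    rw [← hcross, ← Matrix.trace_transpose, Matrix.transpose_mul, Matrix.transpose_transpose]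
  have hexp : frobSq (A - Q * B * Qᵀ) = frobSq A - frobSq B := by
    rw [frobSq_eq_trace, Matrix.transpose_sub, Matrix.sub_mul, Matrix.mul_sub, Matrix.mul_sub,
      Matrix.trace_sub, Matrix.trace_sub, Matrix.trace_sub, hcross, hcross', ← frobSq_eq_trace,
      ← frobSq_eq_trace, frobSq_conj hQ]
    ring
  linarith [frobSq_nonneg (A - Q * B * Qᵀ)]

theorem QFeas.midpoint {k m : ℕ} {dd : Fin m → Fin k → ℝ} {rhs : Fin m → ℝ}
    {p q : (Fin k → ℝ) × Matrix (Fin k) (Fin k) ℝ}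
    (hp : QFeas dd rhs p) (hq : QFeas dd rhs q) :
    QFeas dd rhs ((1 / 2 : ℝ) • (p + q)) := by
  refine ⟨(hp.1.add hq.1).smul _, fun i => ?_⟩
  have h1 := hp.2 i
  have h2 := hq.2 i
  simp only [Prod.smul_fst, Prod.smul_snd, Prod.fst_add, Prod.snd_add, dotProduct_smul,
    dotProduct_add, Matrix.smul_mulVec, Matrix.add_mulVec, smul_eq_mul]
  linarith

/-- The Hessian of an MFN minimizer is unique. -/
theorem MFNMin.snd_eq {k m : ℕ} {dd : Fin m → Fin k → ℝ} {rhs : Fin m → ℝ}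
    {p q : (Fin k → ℝ) × Matrix (Fin k) (Fin k) ℝ}
    (hp : MFNMin dd rhs p) (hq : QFeas dd rhs q) (hle : MFNObj q ≤ MFNObj p) :
    p.2 = q.2 := by
  have hmid := hp.2 _ (hp.1.midpoint hq)
  have hpar := frobSq_midpoint p.2 q.2
  simp only [MFNObj, Prod.smul_snd, Prod.snd_add] at hmid hle
  exact sub_eq_zero.mp (eq_zero_of_frobSq_nonpos (by linarith))

theorem mulVec_dotProduct_eq {n d : ℕ} (Q : Matrix (Fin n) (Fin d) ℝ) (u : Fin d → ℝ)
    (w : Fin n → ℝ) : Q *ᵥ u ⬝ᵥ w = u ⬝ᵥ Qᵀ *ᵥ w := by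
  rw [Matrix.dotProduct_mulVec, Matrix.vecMul_transpose]

/-- Along orthonormal columns, a subspace-feasible pair lifts to a full-space-feasible one. -/
theorem QFeas.lift {n d m : ℕ} {Q : Matrix (Fin n) (Fin d) ℝ} (hQ : Qᵀ * Q = 1)
    {dh : Fin m → Fin d → ℝ} {rhs : Fin m → ℝ} {a : Fin d → ℝ} {A : Matrix (Fin d) (Fin d) ℝ}
    (h : QFeas dh rhs (a, A)) :
    QFeas (fun i => Q *ᵥ dh i) rhs (Q *ᵥ a, Q * A * Qᵀ) := by
  refine ⟨?_, fun i => ?_⟩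
  · have hA : Aᵀ = A := h.1
    simp [Matrix.IsSymm, Matrix.transpose_mul, hA, Matrix.mul_assoc]
  · have hQA : Qᵀ * (Q * A * Qᵀ * Q) = A := by
      rw [Matrix.mul_assoc (Q * A), hQ, Matrix.mul_one, ← Matrix.mul_assoc, hQ, Matrix.one_mul]
    rw [← h.2 i]
    simp only [mulVec_dotProduct_eq, Matrix.mulVec_mulVec, hQ, hQA, Matrix.one_mulVec]

/-- A full-space-feasible pair restricts to a subspace-feasible one. -/
theorem QFeas.restrict {n d m : ℕ} {Q : Matrix (Fin n) (Fin d) ℝ}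
    {dh : Fin m → Fin d → ℝ} {rhs : Fin m → ℝ} {a : Fin n → ℝ} {A : Matrix (Fin n) (Fin n) ℝ}
    (h : QFeas (fun i => Q *ᵥ dh i) rhs (a, A)) :
    QFeas dh rhs (Qᵀ *ᵥ a, Qᵀ * A * Q) := by
  refine ⟨?_, fun i => ?_⟩
  · have hA : Aᵀ = A := h.1
    simp [Matrix.IsSymm, Matrix.transpose_mul, hA, Matrix.mul_assoc]
  · rw [← h.2 i]
    simp only [mulVec_dotProduct_eq, Matrix.mulVec_mulVec, Matrix.mul_assoc]

/-- The Hessian of a full-space MFN minimizer is the lift of that of a subspace one. -/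
theorem MFNMin.snd_eq_lift {n d m : ℕ} {Q : Matrix (Fin n) (Fin d) ℝ} (hQ : Qᵀ * Q = 1)
    {dh : Fin m → Fin d → ℝ} {rhs : Fin m → ℝ} {α : Fin n → ℝ} {H : Matrix (Fin n) (Fin n) ℝ}
    {αh : Fin d → ℝ} {Hh : Matrix (Fin d) (Fin d) ℝ}
    (hmin : MFNMin (fun i => Q *ᵥ dh i) rhs (α, H)) (hminh : MFNMin dh rhs (αh, Hh)) :
    H = Q * Hh * Qᵀ := by
  refine hmin.snd_eq (hminh.1.lift hQ) ?_
  have hle := hminh.2 _ hmin.1.restrict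
  have hcomp := frobSq_compress_le hQ H
  simp only [MFNObj, frobSq_conj hQ] at hle ⊢
  linarith

/-- If the full-space MFN problem is feasible, `(α, H)` is a minimizer
of the full-space MFN problem, `(α̂, Ĥ)` is a minimizer of the subspace MFN problem,
and `α = Q α̂`, then `m(x⁰ + Q x̂ + v) = m̂(x̂)` for every `x̂ ∈ ℝᵈ` and `v ∈ col(Q)⊥`. -/
theorem stmt_7 {n d m : ℕ} (hn : 0 < n) (hd : 0 < d) (hm : 0 < m) (hdn : d < n)
    (Q : Matrix (Fin n) (Fin d) ℝ) (hQ : Qᵀ * Q = 1)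
    (f : (Fin n → ℝ) → ℝ) (x0 : Fin n → ℝ) (dh : Fin m → Fin d → ℝ)
    (fh : (Fin d → ℝ) → ℝ) (hfh : ∀ xh, fh xh = f (x0 + Q.mulVec xh))
    (hfeas : ∃ p, QFeas (fun i => Q.mulVec (dh i))
      (fun i => f (x0 + Q.mulVec (dh i)) - f x0) p)
    (α : Fin n → ℝ) (H : Matrix (Fin n) (Fin n) ℝ)
    (hmin : MFNMin (fun i => Q.mulVec (dh i))
      (fun i => f (x0 + Q.mulVec (dh i)) - f x0) (α, H))
    (αh : Fin d → ℝ) (Hh : Matrix (Fin d) (Fin d) ℝ)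
    (hminh : MFNMin dh (fun i => fh (dh i) - fh 0) (αh, Hh))
    (hrel : α = Q.mulVec αh) :
    ∀ (xh : Fin d → ℝ) (v : Fin n → ℝ), inColPerp Q v →
      f x0 + α ⬝ᵥ (x0 + Q.mulVec xh + v - x0)
        + (1 / 2) * ((x0 + Q.mulVec xh + v - x0) ⬝ᵥ H.mulVec (x0 + Q.mulVec xh + v - x0))
      = fh 0 + αh ⬝ᵥ xh + (1 / 2) * (xh ⬝ᵥ Hh.mulVec xh) := by
  intro xh v hv
  have hrhs : (fun i => fh (dh i) - fh 0) = fun i => f (x0 + Q *ᵥ dh i) - f x0 := by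
    simp [hfh]
  rw [hrhs] at hminh
  have hQv : Qᵀ *ᵥ v = 0 :=
    dotProduct_eq_zero _ fun u => by
      rw [dotProduct_comm, ← mulVec_dotProduct_eq, hv u]
  have hw : Qᵀ *ᵥ (x0 + Q *ᵥ xh + v - x0) = xh := by
    rw [add_assoc, add_sub_cancel_left, Matrix.mulVec_add, hQv, add_zero, Matrix.mulVec_mulVec,
      hQ, Matrix.one_mulVec]
  have hf0 : fh 0 = f x0 := by simp [hfh]
  rw [hmin.snd_eq_lift hQ hminh, hrel, hf0, mulVec_dotProduct_eq, hw, ← Matrix.mulVec_mulVec, hw,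
    ← Matrix.mulVec_mulVec, dotProduct_comm _ (Q *ᵥ Hh *ᵥ xh), mulVec_dotProduct_eq, hw,
    dotProduct_comm xh]
end
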